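/- arXiv:2306.01678 — 8 statements merged into one kernel-verified Lean document; each statement's English description precedes it below -/
import Mathlib

section
/- Let d ≥ 1 and let Q = {e_1, …, e_d} ⊂ ℝ^d be the set of standard unit vectors (e_i has 1 in coordinate i and 0 elsewhere). Then avgp(Q) = sqrt(1 − 1/d)·(1/√2)·diam(Q); in particular avgp(Q) ≥ (1 − 1/d)·(1/√2)·diam(Q), so the upper bound avgp(P) ≤ diam(P)/√2 is essentially tight. -/
open Finset

/-- The centroid of a finite set of points in `ℝ^d`. -/
noncomputable def centroid {d : ℕ} (P : Finset (EuclideanSpace ℝ (Fin d))) :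
    EuclideanSpace ℝ (Fin d) :=
  (P.card : ℝ)⁻¹ • ∑ p ∈ P, p

/-- The average 1-mean price of a finite set of points in `ℝ^d`. -/
noncomputable def avgp {d : ℕ} (P : Finset (EuclideanSpace ℝ (Fin d))) : ℝ :=
  Real.sqrt ((P.card : ℝ)⁻¹ * ∑ p ∈ P, ‖p - centroid P‖ ^ 2)

/-- The diameter of the set of standard unit vectors is `√2` as soon as there are two of them. -/
theorem diam_range_single {ι : Type*} [Fintype ι] [DecidableEq ι] [Nontrivial ι] :
    Metric.diam (Set.range fun i : ι => EuclideanSpace.single i (1 : ℝ)) = Real.sqrt 2 := by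
  have hdist : ∀ i j : ι, i ≠ j →
      dist (EuclideanSpace.single i (1 : ℝ)) (EuclideanSpace.single j (1 : ℝ)) = Real.sqrt 2 := by
    intro i j hij
    rw [dist_eq_norm, ← Real.sqrt_sq (norm_nonneg _), norm_sub_sq_real]
    congr 1
    simp [EuclideanSpace.inner_single_left, hij]
    norm_num
  refine le_antisymm (Metric.diam_le_of_forall_dist_le (Real.sqrt_nonneg 2) ?_) ?_
  · rintro _ ⟨i, rfl⟩ _ ⟨j, rfl⟩
    by_cases hij : i = j
    · simp [hij]
    · exact (hdist i j hij).le
  · obtain ⟨i, j, hij⟩ := exists_pair_ne ι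
    rw [← hdist i j hij]
    exact Metric.dist_le_diam_of_mem (Set.finite_range _).isBounded ⟨i, rfl⟩ ⟨j, rfl⟩

theorem single_one_injective (ι : Type*) [DecidableEq ι] :
    Function.Injective fun i : ι => EuclideanSpace.single i (1 : ℝ) := by
  intro i j h
  by_contra hij
  simpa [hij] using congrArg (fun v : EuclideanSpace ℝ ι => v i) h

/-- The average 1-mean price of the standard unit vectors. -/
theorem avgp_image_single {d : ℕ} (hd : 1 ≤ d) :
    avgp (univ.map ⟨_, single_one_injective (Fin d)⟩) = Real.sqrt (1 - 1 / (d : ℝ)) := by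
  have hd0 : (d : ℝ) ≠ 0 := by positivity
  have hc : ∀ j, centroid (univ.map ⟨_, single_one_injective (Fin d)⟩) j = (d : ℝ)⁻¹ := by
    intro j
    simp [_root_.centroid, Pi.single_apply]
  have hn : ∀ i : Fin d, ‖EuclideanSpace.single i (1 : ℝ) -
      centroid (univ.map ⟨_, single_one_injective (Fin d)⟩)‖ ^ 2 = 1 - 1 / (d : ℝ) := by
    intro i
    rw [norm_sub_sq_real, EuclideanSpace.inner_single_left, hc,
      EuclideanSpace.real_norm_sq_eq (centroid _)]
    simp only [hc]
    simp
    field_simp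
    ring
  simp only [avgp, sum_map, Function.Embedding.coeFn_mk, hn]
  congr 1
  simp
  field_simp

/-- For the set `Q = {e₁, …, e_d}` of standard unit vectors in `ℝ^d` (`d ≥ 1`),
`avgp Q = √(1 - 1/d) · (1/√2) · diam Q`; in particular
`avgp Q ≥ (1 - 1/d) · (1/√2) · diam Q`, so `avgp P ≤ diam P / √2` is essentially tight. -/
theorem avgp_standard_basis {d : ℕ} (hd : 1 ≤ d)
    (Q : Finset (EuclideanSpace ℝ (Fin d)))
    (hQ : (Q : Set (EuclideanSpace ℝ (Fin d))) =
      Set.range (fun i : Fin d => EuclideanSpace.single i (1 : ℝ))) :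
    avgp Q = Real.sqrt (1 - 1 / (d : ℝ)) * (1 / Real.sqrt 2) *
        Metric.diam (Q : Set (EuclideanSpace ℝ (Fin d))) ∧
      (1 - 1 / (d : ℝ)) * (1 / Real.sqrt 2) *
          Metric.diam (Q : Set (EuclideanSpace ℝ (Fin d))) ≤ avgp Q := by
  have hQ' : Q = univ.map ⟨_, single_one_injective (Fin d)⟩ := by
    apply Finset.coe_injective
    simp [hQ]
  have hfst : avgp Q = Real.sqrt (1 - 1 / (d : ℝ)) * (1 / Real.sqrt 2) *
      Metric.diam (Q : Set (EuclideanSpace ℝ (Fin d))) := by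
    rw [hQ, hQ', avgp_image_single hd]
    obtain rfl | hd2 := hd.eq_or_lt
    · simp
    · have : Nontrivial (Fin d) := Fin.nontrivial_iff_two_le.mpr hd2
      rw [diam_range_single, mul_assoc, one_div_mul_cancel (by positivity), mul_one]
  refine ⟨hfst, ?_⟩
  rw [hfst]
  gcongr
  have hle : 1 / (d : ℝ) ≤ 1 := by
    rw [div_le_one (by positivity)]
    exact_mod_cast hd
  have hpos : 0 ≤ 1 / (d : ℝ) := by positivity
  exact Real.le_sqrt_of_sq_le (by nlinarith)
end

section
/- Let P be a finite set of n points in ℝ^d and let r be an integer with 1 ≤ r ≤ n. Then the average, over all r-element subsets R ⊆ P, of ‖∑_{p∈R} (p − c(P))‖² is at most r·avgp(P)². Equivalently, ∑_{R ⊆ P, |R| = r} ‖∑_{p∈R}(p − c(P))‖² ≤ binom(n, r)·r·avgp(P)². -/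
open Finset

/-- Double counting: a sum over `r`-subsets of a squared norm of a sum, expanded over pairs. -/
lemma sum_powersetCard_norm_sum_sq {α E : Type*} [DecidableEq α] [NormedAddCommGroup E]
    [InnerProductSpace ℝ E] (s : Finset α) (f : α → E) (r : ℕ) :
    ∑ R ∈ s.powersetCard r, ‖∑ p ∈ R, f p‖ ^ 2 =
      ∑ p ∈ s, ∑ q ∈ s, (#{R ∈ s.powersetCard r | {p, q} ⊆ R} : ℝ) * inner ℝ (f p) (f q) := by
  have key : ∀ R ∈ s.powersetCard r, ‖∑ p ∈ R, f p‖ ^ 2 =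
      ∑ p ∈ s, ∑ q ∈ s, if {p, q} ⊆ R then inner ℝ (f p) (f q) else 0 := by
    intro R hR
    have hRs : s ∩ R = R := inter_eq_right.2 (mem_powersetCard.1 hR).1
    simp_rw [← real_inner_self_eq_norm_sq, sum_inner, inner_sum]
    simp [insert_subset_iff, ite_and, sum_ite_irrel, sum_ite_mem, hRs]
  rw [sum_congr rfl key, sum_comm]
  refine sum_congr rfl fun p _ => ?_
  rw [sum_comm]
  refine sum_congr rfl fun q _ => ?_
  rw [← sum_filter, sum_const, nsmul_eq_mul]

/-- The number of `r`-subsets of `s` containing two distinct points of `s` is the same for all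
such pairs. -/
lemma exists_card_filter_powersetCard_pair {α : Type*} [DecidableEq α] (s : Finset α) (r : ℕ) :
    ∃ c : ℕ, ∀ p ∈ s, ∀ q ∈ s, p ≠ q → #{R ∈ s.powersetCard r | {p, q} ⊆ R} = c := by
  rcases le_or_gt 2 r with hr | hr
  · refine ⟨(#s - 2).choose (r - 2), fun p hp q hq hpq => ?_⟩
    have h := card_filter_powersetCard_subset {p, q} s r
      (insert_subset hp (singleton_subset_iff.2 hq)) ((card_pair hpq).trans_le hr)
    rwa [card_pair hpq] at h
  · refine ⟨0, fun p _ q _ hpq => card_eq_zero.2 (filter_eq_empty_iff.2 fun R hR hsub => ?_)⟩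
    have := card_le_card hsub
    rw [card_pair hpq, (mem_powersetCard.1 hR).2] at this
    omega

/-- For a family summing to zero, distinct elements of a random subset are nonpositively
correlated. -/
lemma sum_powersetCard_succ_norm_sum_sq_le {α E : Type*} [NormedAddCommGroup E]
    [InnerProductSpace ℝ E] (s : Finset α) (f : α → E) (hf : ∑ p ∈ s, f p = 0) (k : ℕ) :
    ∑ R ∈ s.powersetCard (k + 1), ‖∑ p ∈ R, f p‖ ^ 2 ≤
      ((#s - 1).choose k : ℝ) * ∑ p ∈ s, ‖f p‖ ^ 2 := by
  classical
  obtain ⟨c, hc⟩ := exists_card_filter_powersetCard_pair s (k + 1)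
  rw [sum_powersetCard_norm_sum_sq, mul_sum]
  refine sum_le_sum fun p hp => ?_
  have hdiag : #{R ∈ s.powersetCard (k + 1) | {p, p} ⊆ R} = (#s - 1).choose k := by
    simpa using card_filter_powersetCard_subset {p} s (k + 1) (by simpa using hp) (by simp)
  have hzero : ∑ q ∈ s.erase p, inner ℝ (f p) (f q) = -‖f p‖ ^ 2 := by
    rw [← inner_sum, sum_erase_eq_sub hp, hf, zero_sub, inner_neg_right,
      real_inner_self_eq_norm_sq]
  rw [← add_sum_erase s _ hp, hdiag, real_inner_self_eq_norm_sq,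
    sum_congr rfl fun q hq => by
      rw [hc p hp q (mem_of_mem_erase hq) (ne_of_mem_erase hq).symm],
    ← mul_sum, hzero]
  nlinarith [mul_nonneg (Nat.cast_nonneg (α := ℝ) c) (sq_nonneg ‖f p‖)]

lemma sum_sub_centroid {d : ℕ} (P : Finset (EuclideanSpace ℝ (Fin d))) :
    ∑ p ∈ P, (p - centroid P) = 0 := by
  rcases P.eq_empty_or_nonempty with rfl | hP
  · simp
  · have : (#P : ℝ) ≠ 0 := by exact_mod_cast hP.card_pos.ne'
    rw [sum_sub_distrib, sum_const, ← Nat.cast_smul_eq_nsmul ℝ, _root_.centroid, smul_inv_smul₀ this,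
      sub_self]

/-- Summed over all `r`-element subsets `R ⊆ P`, the quantity
`‖∑_{p ∈ R} (p - c(P))‖²` is at most `binom(n,r) · r · avgp(P)²`; equivalently, its
average over such subsets is at most `r · avgp(P)²`. -/
theorem sum_powersetCard_norm_sq_le {d : ℕ} (P : Finset (EuclideanSpace ℝ (Fin d)))
    (n r : ℕ) (hn : P.card = n) (hr1 : 1 ≤ r) (hrn : r ≤ n) :
    ∑ R ∈ P.powersetCard r, ‖∑ p ∈ R, (p - centroid P)‖ ^ 2 ≤
      (n.choose r : ℝ) * r * avgp P ^ 2 := by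
  obtain ⟨k, rfl⟩ := Nat.exists_eq_add_of_le' hr1
  obtain ⟨m, rfl⟩ := Nat.exists_eq_add_of_le' (hr1.trans hrn)
  refine (sum_powersetCard_succ_norm_sum_sq_le P _ (sum_sub_centroid P) k).trans_eq ?_
  have hchoose : ((m + 1 : ℕ) : ℝ) * m.choose k = (m + 1).choose (k + 1) * (k + 1 : ℕ) := by
    exact_mod_cast Nat.add_one_mul_choose_eq m k
  have hm : ((m + 1 : ℕ) : ℝ) ≠ 0 := by positivity
  rw [avgp, Real.sq_sqrt (by positivity), hn, ← hchoose, Nat.add_sub_cancel]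
  field_simp
end

section
/- Let P be a finite set of n points in ℝ^d, let ε ∈ (0,1) and ζ > 1 be parameters, and let r be an integer with ζ/ε² ≤ r ≤ n. Then the number of r-element subsets R ⊆ P satisfying ‖c(R) − c(P)‖ > ε·avgp(P) is at most (1/ζ)·binom(n, r). Equivalently, a uniformly random sample of size r picked without replacement from P has centroid within distance ε·avgp(P) of c(P) with probability at least 1 − 1/ζ. -/
open Finset
open scoped Classical

/-- The number of `r`-element subsets of `P` containing a given subset `T`. -/
lemma card_powersetCard_filter_superset {α : Type*} {P T : Finset α} {r : ℕ}
    (hT : T ⊆ P) (hr : r ≤ P.card) :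
    ((P.powersetCard r).filter (fun R => T ⊆ R)).card =
      (P.card - T.card).choose (P.card - r) := by
  rw [← card_sdiff_of_subset hT, ← card_powersetCard]
  refine card_nbij' (fun R => P \ R) (fun R => P \ R) ?_ ?_ ?_ ?_
  · intro R hR
    simp only [mem_coe, mem_filter, mem_powersetCard] at hR
    simp only [mem_coe, mem_powersetCard]
    exact ⟨sdiff_subset_sdiff le_rfl hR.2, by rw [card_sdiff_of_subset hR.1.1, hR.1.2]⟩
  · intro R hR
    simp only [mem_coe, mem_powersetCard] at hR
    have hRP : R ⊆ P := hR.1.trans sdiff_subset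
    simp only [mem_coe, mem_filter, mem_powersetCard]
    refine ⟨⟨sdiff_subset, ?_⟩, ?_⟩
    · rw [card_sdiff_of_subset hRP, hR.2]
      omega
    · intro x hx
      exact mem_sdiff.2 ⟨hT hx, fun h => (mem_sdiff.1 (hR.1 h)).2 hx⟩
  · intro R hR
    simp only [mem_coe, mem_filter, mem_powersetCard] at hR
    exact Finset.sdiff_sdiff_eq_self hR.1.1
  · intro R hR
    simp only [mem_coe, mem_powersetCard] at hR
    exact Finset.sdiff_sdiff_eq_self (hR.1.trans sdiff_subset)

/-- The second moment of the sum of a random `r`-element sample, drawn without replacement from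
vectors summing to zero, is at most `r` times their mean squared norm. -/
lemma sum_powersetCard_norm_sum_sq_le {α E : Type*} [NormedAddCommGroup E]
    [InnerProductSpace ℝ E] {P : Finset α} {r : ℕ} (v : α → E)
    (hv : ∑ p ∈ P, v p = 0) (hr : r ≤ P.card) :
    ∑ R ∈ P.powersetCard r, ‖∑ p ∈ R, v p‖ ^ 2 ≤
      ((P.card - 1).choose (P.card - r) : ℝ) * ∑ p ∈ P, ‖v p‖ ^ 2 := by
  set A : ℝ := ((P.card - 1).choose (P.card - r) : ℝ)
  set B : ℝ := ((P.card - 2).choose (P.card - r) : ℝ)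
  have expand : ∀ R ∈ P.powersetCard r, ‖∑ p ∈ R, v p‖ ^ 2 =
      ∑ p ∈ P, ∑ q ∈ P, if {p, q} ⊆ R then inner ℝ (v p) (v q) else 0 := by
    intro R hR
    have hRP := (mem_powersetCard.1 hR).1
    rw [← real_inner_self_eq_norm_sq, sum_inner, ← sum_subset hRP]
    · refine sum_congr rfl fun p hp => ?_
      rw [inner_sum, ← sum_subset hRP]
      · refine sum_congr rfl fun q hq => ?_
        rw [if_pos (by simp [insert_subset_iff, hp, hq])]
      · intro q _ hq
        simp [insert_subset_iff, hq]
    · intro p _ hp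
      simp [insert_subset_iff, hp]
  have count : ∀ p ∈ P, ∀ q ∈ P,
      ∑ R ∈ P.powersetCard r, (if {p, q} ⊆ R then inner ℝ (v p) (v q) else 0) =
        B * inner ℝ (v p) (v q) + if p = q then (A - B) * ‖v p‖ ^ 2 else 0 := by
    intro p hp q hq
    rw [← sum_filter, sum_const,
      card_powersetCard_filter_superset (by simp [insert_subset_iff, hp, hq]) hr, nsmul_eq_mul]
    split_ifs with h
    · subst h
      rw [real_inner_self_eq_norm_sq]
      simp only [pair_eq_singleton, card_singleton]
      ring
    · rw [card_pair h, add_zero]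
  have hzero : ∑ p ∈ P, ∑ q ∈ P, inner ℝ (v p) (v q) = 0 := by
    simp_rw [← inner_sum, hv, inner_zero_right, sum_const_zero]
  have hcross : ∑ p ∈ P, ∑ q ∈ P, B * inner ℝ (v p) (v q) = 0 := by
    simp_rw [← mul_sum, hzero, mul_zero]
  calc ∑ R ∈ P.powersetCard r, ‖∑ p ∈ R, v p‖ ^ 2
      = ∑ p ∈ P, ∑ q ∈ P, ∑ R ∈ P.powersetCard r,
          (if {p, q} ⊆ R then inner ℝ (v p) (v q) else 0) := by
        rw [sum_congr rfl expand, sum_comm]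
        exact sum_congr rfl fun p _ => sum_comm
    _ = ∑ p ∈ P, ∑ q ∈ P,
          (B * inner ℝ (v p) (v q) + if p = q then (A - B) * ‖v p‖ ^ 2 else 0) :=
        sum_congr rfl fun p hp => sum_congr rfl fun q hq => count p hp q hq
    _ = (A - B) * ∑ p ∈ P, ‖v p‖ ^ 2 := by
        simp_rw [sum_add_distrib]
        rw [hcross, zero_add, mul_sum]
        exact sum_congr rfl fun p hp => by rw [sum_ite_eq, if_pos hp]
    _ ≤ A * ∑ p ∈ P, ‖v p‖ ^ 2 := by
        have : 0 ≤ B := Nat.cast_nonneg _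
        gcongr
        linarith

/-- The expected squared distance between the centroids of a random `r`-element subset of `P` and
of `P` itself is at most `avgp P ^ 2 / r`. -/
lemma sum_powersetCard_norm_centroid_sub_sq_le {d : ℕ} (P : Finset (EuclideanSpace ℝ (Fin d)))
    {r : ℕ} (hr : 0 < r) (hrP : r ≤ P.card) :
    ∑ R ∈ P.powersetCard r, ‖centroid R - centroid P‖ ^ 2 ≤
      (P.card.choose r : ℝ) * avgp P ^ 2 / r := by
  have hn : (0 : ℝ) < P.card := by exact_mod_cast hr.trans_le hrP
  have hr' : (0 : ℝ) < r := by exact_mod_cast hr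
  have hv : ∑ p ∈ P, (p - centroid P) = 0 := by
    rw [sum_sub_distrib, sum_const, ← Nat.cast_smul_eq_nsmul ℝ, _root_.centroid, smul_smul,
      mul_inv_cancel₀ hn.ne', one_smul, sub_self]
  have hcent : ∀ R ∈ P.powersetCard r, ‖centroid R - centroid P‖ ^ 2 =
      ((r : ℝ) ^ 2)⁻¹ * ‖∑ p ∈ R, (p - centroid P)‖ ^ 2 := by
    intro R hR
    have hRr := (mem_powersetCard.1 hR).2
    have : centroid R - centroid P = (r : ℝ)⁻¹ • ∑ p ∈ R, (p - centroid P) := by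
      rw [sum_sub_distrib, sum_const, ← Nat.cast_smul_eq_nsmul ℝ, smul_sub, smul_smul, hRr,
        inv_mul_cancel₀ hr'.ne', one_smul, _root_.centroid, hRr]
    rw [this, norm_smul, mul_pow, norm_inv, Real.norm_natCast, inv_pow]
  have hchoose : ((P.card - 1).choose (P.card - r) : ℝ) * P.card = P.card.choose r * r := by
    have h := Nat.choose_mul_succ_eq (P.card - 1) (P.card - r)
    rw [Nat.sub_add_cancel (hr.trans_le hrP), Nat.sub_sub_self hrP, Nat.choose_symm hrP] at h
    exact_mod_cast h
  have havgp : avgp P ^ 2 = (P.card : ℝ)⁻¹ * ∑ p ∈ P, ‖p - centroid P‖ ^ 2 :=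
    Real.sq_sqrt (by positivity)
  rw [sum_congr rfl hcent, ← mul_sum]
  calc _ ≤ ((r : ℝ) ^ 2)⁻¹ * (((P.card - 1).choose (P.card - r) : ℝ) *
          ∑ p ∈ P, ‖p - centroid P‖ ^ 2) := by
        gcongr
        exact sum_powersetCard_norm_sum_sq_le (fun p => p - centroid P) hv hrP
    _ = _ := by
        rw [eq_div_of_mul_eq hn.ne' hchoose, havgp]
        field_simp

/-- Mean sampling (without replacement): if `ζ/ε² ≤ r ≤ n`, the number of `r`-element
subsets `R ⊆ P` with `‖c(R) - c(P)‖ > ε · avgp(P)` is at most `(1/ζ) · binom(n,r)`. -/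
theorem card_bad_subsets_le {d : ℕ} (P : Finset (EuclideanSpace ℝ (Fin d)))
    (n r : ℕ) (ε ζ : ℝ) (hn : P.card = n) (hε : ε ∈ Set.Ioo (0 : ℝ) 1) (hζ : 1 < ζ)
    (hr : ζ / ε ^ 2 ≤ (r : ℝ)) (hrn : r ≤ n) :
    (((P.powersetCard r).filter
        (fun R => ε * avgp P < ‖centroid R - centroid P‖)).card : ℝ) ≤
      (1 / ζ) * (n.choose r : ℝ) := by
  subst hn
  have hε0 : 0 < ε := hε.1
  have hζ0 : 0 < ζ := by linarith
  have hr' : (0 : ℝ) < r := lt_of_lt_of_le (by positivity) hr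
  have hmoment := sum_powersetCard_norm_centroid_sub_sq_le P (Nat.cast_pos.1 hr') hrn
  have havgp : 0 ≤ avgp P := Real.sqrt_nonneg _
  set S := (P.powersetCard r).filter
    (fun R => ε * avgp P < ‖centroid R - centroid P‖)
  have hle : ∑ R ∈ S, ‖centroid R - centroid P‖ ^ 2 ≤
      (P.card.choose r : ℝ) * avgp P ^ 2 / r :=
    (sum_le_sum_of_subset_of_nonneg (filter_subset _ _) fun _ _ _ => sq_nonneg _).trans hmoment
  rcases havgp.eq_or_lt with h0 | hpos
  · have hempty : S = ∅ := by
      by_contra hne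
      have : 0 < ∑ R ∈ S, ‖centroid R - centroid P‖ ^ 2 := by
        refine sum_pos (fun R hR => ?_) (nonempty_iff_ne_empty.2 hne)
        have hlt := (mem_filter.1 hR).2
        rw [← h0, mul_zero] at hlt
        positivity
      rw [← h0] at hle
      norm_num at hle
      linarith
    rw [hempty, card_empty, Nat.cast_zero]
    positivity
  · have hmarkov : (S.card : ℝ) * (ε * avgp P) ^ 2 ≤
        ∑ R ∈ S, ‖centroid R - centroid P‖ ^ 2 := by
      rw [← nsmul_eq_mul]
      refine card_nsmul_le_sum _ _ _ fun R hR => ?_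
      have hlt := (mem_filter.1 hR).2
      gcongr
    have h := hmarkov.trans hle
    rw [le_div_iff₀ hr'] at h
    have hcard : (S.card : ℝ) * (ε ^ 2 * r) ≤ P.card.choose r :=
      le_of_mul_le_mul_right (by linarith) (pow_pos hpos 2)
    rw [div_le_iff₀ (by positivity)] at hr
    rw [one_div, inv_mul_eq_div, le_div_iff₀ hζ0]
    calc (S.card : ℝ) * ζ ≤ S.card * (ε ^ 2 * r) := by
          gcongr
          linarith
      _ ≤ _ := hcard
end

section
/- (No-dimensional Tverberg theorem.) Let P be a set of n points in ℝ^d and let ε ∈ (0, 1/√2) be a parameter with n ≥ 27/ε⁴. Then there exists a partition of P into k pairwise disjoint nonempty sets P_1, …, P_k, and a closed ball B of radius at most ε·diam(P), such that: (i) |P_i| ≤ 4/ε² + 9/2 for every i; (ii) for every i, the convex hull of P_i intersects B; and (iii) k ≥ n/(4/ε² + 9/2). -/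
open Finset

/-- The elements of a finite grid of vectors can be rearranged so that any two row sums are close:
a rearrangement minimizing the sum of the squared norms of the row sums has this property. -/
theorem exists_perm_norm_sum_sub_sum_sq_le {E ι κ : Type*} [NormedAddCommGroup E]
    [InnerProductSpace ℝ E] [Fintype ι] [Fintype κ] (f : ι × κ → E) (D : ℝ)
    (hD : ∀ u v, ‖f u - f v‖ ≤ D) :
    ∃ σ : Equiv.Perm (ι × κ), ∀ i j,
      ‖∑ a, f (σ (i, a)) - ∑ a, f (σ (j, a))‖ ^ 2 ≤ Fintype.card κ * D ^ 2 := by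
  classical
  obtain ⟨σ, hσ⟩ := Finite.exists_min
    (fun σ : Equiv.Perm (ι × κ) ↦ ∑ i, ‖∑ a, f (σ (i, a))‖ ^ 2)
  refine ⟨σ, fun i j ↦ ?_⟩
  rcases eq_or_ne i j with rfl | hij
  · rw [sub_self, norm_zero, zero_pow two_ne_zero]
    positivity
  set S : ι → E := fun r ↦ ∑ a, f (σ (r, a)) with hS
  have swap_le (a b : κ) :
      0 ≤ inner ℝ (S i - S j) (f (σ (j, b)) - f (σ (i, a))) + D ^ 2 := by
    set δ := f (σ (j, b)) - f (σ (i, a)) with hδ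
    have hpt (x : ι × κ) : f (σ (Equiv.swap (i, a) (j, b) x)) =
        f (σ x) + (if x = (i, a) then δ else 0) + (if x = (j, b) then -δ else 0) := by
      have hne : (j, b) ≠ (i, a) := fun h ↦ hij (congrArg Prod.fst h).symm
      by_cases h1 : x = (i, a)
      · subst h1
        simp [hδ, hne.symm]
      · by_cases h2 : x = (j, b)
        · subst h2
          simp [hδ, hne]
        · simp [Equiv.swap_apply_of_ne_of_ne h1 h2, h1, h2]
    have hrow (r : ι) : ∑ c, f ((Equiv.swap (i, a) (j, b)).trans σ (r, c)) =
        S r + (if r = i then δ else 0) + (if r = j then -δ else 0) := by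
      simp only [Equiv.trans_apply, hpt, Finset.sum_add_distrib, Prod.mk.injEq, ite_and, hS]
      congr 2 <;> split_ifs <;> simp
    have hsq (r : ι) : ‖S r + (if r = i then δ else 0) + (if r = j then -δ else 0)‖ ^ 2 =
        ‖S r‖ ^ 2 + (if r = i then 2 * inner ℝ (S i) δ + ‖δ‖ ^ 2 else 0) +
          (if r = j then -2 * inner ℝ (S j) δ + ‖δ‖ ^ 2 else 0) := by
      by_cases h1 : r = i
      · subst h1
        simp [hij, norm_add_sq_real, add_assoc]
      · by_cases h2 : r = j
        · subst h2
          simp only [h1, if_false, if_true, add_zero]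
          rw [norm_add_sq_real, inner_neg_right, norm_neg]
          ring
        · simp [h1, h2]
    have hmin := hσ ((Equiv.swap (i, a) (j, b)).trans σ)
    simp only [hrow, hsq, Finset.sum_add_distrib, Finset.sum_ite_eq', Finset.mem_univ,
      if_true] at hmin
    have hδD : ‖δ‖ ^ 2 ≤ D ^ 2 := pow_le_pow_left₀ (norm_nonneg _) (hD _ _) 2
    rw [inner_sub_left]
    change ∑ r, ‖S r‖ ^ 2 ≤ _ at hmin
    linarith
  have hsum := Finset.sum_nonneg fun a (_ : a ∈ (univ : Finset κ)) ↦
    Finset.sum_nonneg fun b (_ : b ∈ (univ : Finset κ)) ↦ swap_le a b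
  have heq : ∑ a : κ, ∑ b : κ,
      (inner ℝ (S i - S j) (f (σ (j, b)) - f (σ (i, a))) + D ^ 2) =
      Fintype.card κ * (Fintype.card κ * D ^ 2 - ‖S i - S j‖ ^ 2) := by
    simp only [Finset.sum_add_distrib, ← inner_sum, Finset.sum_sub_distrib, Finset.sum_const,
      Finset.card_univ, ← Finset.smul_sum, ← smul_sub]
    rw [← real_inner_self_eq_norm_sq, ← neg_sub (S i) (S j)]
    simp only [hS, inner_neg_right, ← Nat.cast_smul_eq_nsmul ℝ, inner_smul_right, smul_eq_mul]
    ring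
  rw [heq] at hsum
  rcases isEmpty_or_nonempty κ with hκ | hκ
  · simp
  · have hpos : (0 : ℝ) < Fintype.card κ := by exact_mod_cast Fintype.card_pos
    have := nonneg_of_mul_nonneg_right hsum hpos
    change ‖S i - S j‖ ^ 2 ≤ _
    linarith

/-- A finite set of at least `m` points can be partitioned into sets of fewer than `2 * m` points,
whose convex hulls all meet a ball of radius `diam P / √m`. -/
theorem exists_partition_convexHull_inter_closedBall {E : Type*} [NormedAddCommGroup E]
    [InnerProductSpace ℝ E] (P : Finset E) {m : ℕ} (hm : 0 < m) (hmP : m ≤ P.card) :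
    ∃ (k : ℕ) (Q : Fin k → Finset E) (x : E),
      (∀ i, (Q i).Nonempty) ∧ (∀ i j, i ≠ j → Disjoint (Q i) (Q j)) ∧
      (⋃ i, (Q i : Set E)) = (P : Set E) ∧ (∀ i, (Q i).card < 2 * m) ∧
      ∀ i, (convexHull ℝ (Q i : Set E) ∩
        Metric.closedBall x (Metric.diam (P : Set E) / √m)).Nonempty := by
  classical
  set k := P.card / m with hk
  have hk0 : 0 < k := Nat.div_pos hmP hm
  obtain ⟨f⟩ : Nonempty (Fin k × Fin m ↪ P) := Function.Embedding.nonempty_of_card_le (by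
    simpa using Nat.div_mul_le_self P.card m)
  obtain ⟨σ, hσ⟩ := exists_perm_norm_sum_sub_sum_sq_le (fun u ↦ (f u : E))
    (Metric.diam (P : Set E)) fun u v ↦ by
      rw [← dist_eq_norm]
      exact Metric.dist_le_diam_of_mem P.finite_toSet.isBounded (f u).2 (f v).2
  set g : Fin k × Fin m → E := fun u ↦ f (σ u) with hg
  have hginj : Function.Injective g :=
    Subtype.val_injective.comp (f.injective.comp σ.injective)
  have hgP (u) : g u ∈ P := (f (σ u)).2
  let i₀ : Fin k := ⟨0, hk0⟩
  let row (i : Fin k) : Finset E := univ.image fun a ↦ g (i, a)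
  let rest : Finset E := P \ univ.image g
  have hrow (i) : (row i).card = m := by
    rw [Finset.card_image_of_injective _ fun a b h ↦ (Prod.mk.inj (hginj h)).2]
    simp
  have hrest : rest.card < m := by
    rw [Finset.card_sdiff_of_subset (Finset.image_subset_iff.2 fun u _ ↦ hgP u),
      Finset.card_image_of_injective _ hginj]
    simp only [Finset.card_univ, Fintype.card_prod, Fintype.card_fin]
    have := Nat.mod_lt P.card hm
    have := Nat.div_add_mod' P.card m
    rw [← hk] at this
    omega
  have hrow_rest (i) : Disjoint (row i) rest := by
    refine Finset.disjoint_left.2 fun y hy hy' ↦ ?_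
    obtain ⟨a, -, rfl⟩ := Finset.mem_image.1 hy
    exact (Finset.mem_sdiff.1 hy').2 (Finset.mem_image_of_mem g (Finset.mem_univ _))
  have hrow_row (i j) (hij : i ≠ j) : Disjoint (row i) (row j) := by
    refine Finset.disjoint_left.2 fun y hy hy' ↦ ?_
    obtain ⟨a, -, rfl⟩ := Finset.mem_image.1 hy
    obtain ⟨b, -, hb⟩ := Finset.mem_image.1 hy'
    exact hij (Prod.mk.inj (hginj hb)).1.symm
  have hmem (i a) : g (i, a) ∈ row i := Finset.mem_image_of_mem _ (Finset.mem_univ a)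
  let c (i : Fin k) : E := (m : ℝ)⁻¹ • ∑ a, g (i, a)
  have hmR : (0 : ℝ) < m := by exact_mod_cast hm
  refine ⟨k, fun i ↦ row i ∪ if i = i₀ then rest else ∅, c i₀, fun i ↦ ?_, fun i j hij ↦ ?_,
    ?_, fun i ↦ ?_, fun i ↦ ⟨c i, ?_, ?_⟩⟩
  · exact ⟨g (i, ⟨0, hm⟩), Finset.mem_union_left _ (hmem _ _)⟩
  · have h₁ := hrow_row i j hij
    by_cases hi : i = i₀
    · have hj : j ≠ i₀ := fun h ↦ hij (hi.trans h.symm)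
      simp only [hi, hj, if_true, if_false, Finset.union_empty, Finset.disjoint_union_left]
      exact ⟨hi ▸ h₁, (hrow_rest j).symm⟩
    · simp only [hi, if_false, Finset.union_empty, Finset.disjoint_union_right]
      refine ⟨h₁, ?_⟩
      split_ifs
      · exact hrow_rest i
      · exact Finset.disjoint_empty_right _
  · ext y
    simp only [Set.mem_iUnion, Finset.mem_coe, Finset.mem_union]
    constructor
    · rintro ⟨i, hy | hy⟩
      · obtain ⟨a, -, rfl⟩ := Finset.mem_image.1 hy
        exact hgP _
      · split_ifs at hy
        · exact (Finset.mem_sdiff.1 hy).1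
        · simp at hy
    · intro hy
      by_cases h : y ∈ univ.image g
      · obtain ⟨⟨i, a⟩, -, rfl⟩ := Finset.mem_image.1 h
        exact ⟨i, Or.inl (hmem i a)⟩
      · exact ⟨i₀, Or.inr (by simpa only [if_true] using Finset.mem_sdiff.2 ⟨hy, h⟩)⟩
  · have h₁ : (if i = i₀ then rest else ∅).card < m := by
      split_ifs
      · exact hrest
      · simpa using hm
    have := Finset.card_union_le (row i) (if i = i₀ then rest else ∅)
    have := hrow i
    dsimp only
    omega
  · have hmem_hull (a : Fin m) (_ : a ∈ (univ : Finset (Fin m))) :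
        g (i, a) ∈ convexHull ℝ
          ((row i ∪ if i = i₀ then rest else ∅ : Finset E) : Set E) :=
      subset_convexHull ℝ _ (Finset.mem_coe.2 (Finset.mem_union_left _ (hmem i a)))
    have := (convex_convexHull ℝ _).sum_mem (t := univ) (w := fun _ : Fin m ↦ (m : ℝ)⁻¹)
      (fun _ _ ↦ by positivity) (by simp [hmR.ne']) hmem_hull
    rwa [← Finset.smul_sum] at this
  · have h := hσ i i₀
    rw [Fintype.card_fin] at h
    rw [Metric.mem_closedBall, dist_eq_norm, ← smul_sub, norm_smul, norm_inv,
      Real.norm_of_nonneg hmR.le, le_div_iff₀ (Real.sqrt_pos.2 hmR)]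
    refine abs_le_of_sq_le_sq' ?_ Metric.diam_nonneg |>.2
    rw [mul_pow, mul_pow, Real.sq_sqrt hmR.le, inv_pow, ← mul_comm (m : ℝ), ← mul_assoc]
    calc (m : ℝ) * ((m : ℝ) ^ 2)⁻¹ * ‖∑ a, g (i, a) - ∑ a, g (i₀, a)‖ ^ 2
        ≤ (m : ℝ) * ((m : ℝ) ^ 2)⁻¹ * (m * Metric.diam (P : Set E) ^ 2) := by gcongr
      _ = Metric.diam (P : Set E) ^ 2 := by field_simp

/-- No-dimensional Tverberg theorem: for `ε ∈ (0, 1/√2)` and `n ≥ 27/ε⁴`, the set `P`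
can be partitioned into `k ≥ n/(4/ε² + 9/2)` nonempty sets, each of size at most
`4/ε² + 9/2`, whose convex hulls all intersect a common closed ball of radius at most
`ε · diam(P)`. -/
theorem no_dimensional_tverberg {d : ℕ} (P : Finset (EuclideanSpace ℝ (Fin d)))
    (n : ℕ) (ε : ℝ) (hn : P.card = n) (hε : 0 < ε ∧ ε < 1 / Real.sqrt 2)
    (hbig : (27 : ℝ) / ε ^ 4 ≤ (n : ℝ)) :
    ∃ (k : ℕ) (Q : Fin k → Finset (EuclideanSpace ℝ (Fin d)))
      (x : EuclideanSpace ℝ (Fin d)) (ρ : ℝ),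
      ρ ≤ ε * Metric.diam (P : Set (EuclideanSpace ℝ (Fin d))) ∧
      (∀ i, (Q i).Nonempty) ∧
      (∀ i j, i ≠ j → Disjoint (Q i) (Q j)) ∧
      (⋃ i, (Q i : Set (EuclideanSpace ℝ (Fin d)))) = (P : Set (EuclideanSpace ℝ (Fin d))) ∧
      (∀ i, ((Q i).card : ℝ) ≤ 4 / ε ^ 2 + 9 / 2) ∧
      (∀ i, (convexHull ℝ (Q i : Set (EuclideanSpace ℝ (Fin d))) ∩
          Metric.closedBall x ρ).Nonempty) ∧
      (n : ℝ) / (4 / ε ^ 2 + 9 / 2) ≤ (k : ℝ) := by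
  obtain ⟨hε0, hε1⟩ := hε
  have hε2 : 2 < 1 / ε ^ 2 := by
    have h : ε ^ 2 < (1 / √2) ^ 2 := pow_lt_pow_left₀ hε1 hε0.le two_ne_zero
    rw [div_pow, one_pow, Real.sq_sqrt zero_le_two] at h
    rw [lt_div_iff₀ (by positivity)]
    linarith
  set t := 1 / ε ^ 2 with ht
  have h4 : 4 / ε ^ 2 = 4 * t := by rw [ht]; ring
  have h27 : 27 / ε ^ 4 = 27 * t ^ 2 := by rw [ht]; field_simp
  rw [h27] at hbig
  rw [h4]
  have htm : t ≤ ⌈t⌉₊ := Nat.le_ceil t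
  have hmt : (⌈t⌉₊ : ℝ) < t + 1 := Nat.ceil_lt_add_one (by linarith)
  have hm : 0 < ⌈t⌉₊ := Nat.ceil_pos.2 (by linarith)
  have hmP : ⌈t⌉₊ ≤ P.card := by
    rw [hn, ← Nat.cast_le (α := ℝ)]
    nlinarith
  obtain ⟨k, Q, x, hne, hdisj, hunion, hcard, hball⟩ :=
    exists_partition_convexHull_inter_closedBall P hm hmP
  have hcard' (i) : ((Q i).card : ℝ) ≤ 4 * t + 9 / 2 := by
    have : ((Q i).card : ℝ) < 2 * ⌈t⌉₊ := by exact_mod_cast hcard i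
    linarith
  refine ⟨k, Q, x, _, ?_, hne, hdisj, hunion, hcard', hball, ?_⟩
  · rw [div_eq_mul_inv, mul_comm]
    refine mul_le_mul_of_nonneg_right (inv_le_of_inv_le₀ hε0 ?_) Metric.diam_nonneg
    refine Real.le_sqrt_of_sq_le ?_
    rwa [inv_pow, ← one_div]
  · rw [div_le_iff₀ (by linarith), ← hn]
    classical
    have hP : P = univ.biUnion Q := by
      rw [← Finset.coe_inj, ← hunion]
      simp
    calc (P.card : ℝ) ≤ ∑ i, ((Q i).card : ℝ) := by
          rw [hP]
          exact_mod_cast Finset.card_biUnion_le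
      _ ≤ ∑ _i : Fin k, (4 * t + 9 / 2) := Finset.sum_le_sum fun i _ ↦ hcard' i
      _ = k * (4 * t + 9 / 2) := by rw [Fin.sum_const, nsmul_eq_mul]
end

section
/- Let U be a set of 2n points in ℝ^d with Δ = diam(U). Then U can be partitioned into two disjoint sets P and Q, each of exactly n points, such that ‖c(P) − c(Q)‖ ≤ Δ/√n. -/
open Finset
open scoped Classical

/-- A set of `2n` points whose pairwise distances are at most `D` splits into two halves whose
sums differ by a vector of squared norm at most `n D²`. -/
theorem exists_halving_norm_sum_sub_sum_sq_le {E : Type*} [NormedAddCommGroup E]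
    [InnerProductSpace ℝ E] {D : ℝ} (n : ℕ) (U : Finset E) (hU : U.card = 2 * n)
    (hD : ∀ x ∈ U, ∀ y ∈ U, ‖x - y‖ ≤ D) :
    ∃ P Q : Finset E, Disjoint P Q ∧ P ∪ Q = U ∧ P.card = n ∧ Q.card = n ∧
      ‖∑ p ∈ P, p - ∑ q ∈ Q, q‖ ^ 2 ≤ n * D ^ 2 := by
  induction n generalizing U with
  | zero => exact ⟨∅, ∅, by simp_all⟩
  | succ n ih =>
    obtain ⟨a, ha, b, hb, hab⟩ := Finset.one_lt_card.mp (show 1 < U.card by omega)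
    have hb' : b ∈ U.erase a := mem_erase.mpr ⟨hab.symm, hb⟩
    obtain ⟨P, Q, hPQ, hPQU, hP, hQ, hle⟩ := ih ((U.erase a).erase b)
      (by rw [card_erase_of_mem hb', card_erase_of_mem ha]; omega)
      fun x hx y hy => hD x (mem_of_mem_erase (mem_of_mem_erase hx)) y
        (mem_of_mem_erase (mem_of_mem_erase hy))
    -- Orient the pair so that its difference makes a nonacute angle with the difference so far.
    obtain ⟨x, y, hxU, hyU, hxy, hUxy, hinner⟩ : ∃ x y, x ∈ U ∧ y ∈ U ∧ x ≠ y ∧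
        (U.erase x).erase y = P ∪ Q ∧ inner ℝ (∑ p ∈ P, p - ∑ q ∈ Q, q) (x - y) ≤ 0 := by
      rcases le_total (inner ℝ (∑ p ∈ P, p - ∑ q ∈ Q, q) (a - b)) 0 with h | h
      · exact ⟨a, b, ha, hb, hab, hPQU.symm, h⟩
      · refine ⟨b, a, hb, ha, hab.symm, by rw [erase_right_comm, hPQU], ?_⟩
        rw [← neg_sub a b, inner_neg_right]
        linarith
    have hmem (z : E) : z ∈ P ∪ Q ↔ z ≠ y ∧ z ≠ x ∧ z ∈ U := by
      rw [← hUxy, mem_erase, mem_erase]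
    have hx : x ∉ P ∪ Q := fun h => ((hmem x).mp h).2.1 rfl
    have hy : y ∉ P ∪ Q := fun h => ((hmem y).mp h).1 rfl
    rw [mem_union, not_or] at hx hy
    refine ⟨insert x P, insert y Q, ?_, ?_, ?_, ?_, ?_⟩
    · simp [disjoint_insert_left, disjoint_insert_right, hxy.symm, hx, hy, hPQ]
    · ext z
      have := hmem z
      simp only [mem_union, mem_insert] at this ⊢
      grind
    · rw [card_insert_of_notMem hx.1, hP]
    · rw [card_insert_of_notMem hy.2, hQ]
    · have hsq : ‖x - y‖ ^ 2 ≤ D ^ 2 := by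
        gcongr
        exact hD x hxU y hyU
      rw [sum_insert hx.1, sum_insert hy.2, add_sub_add_comm, add_comm, norm_add_sq_real]
      push_cast
      linarith

/-- A set `U` of `2n` points in `ℝ^d` can be partitioned into two disjoint sets `P` and
`Q` of `n` points each with `‖c(P) - c(Q)‖ ≤ diam(U)/√n`. -/
theorem halving_partition {d n : ℕ} (hn : 0 < n)
    (U : Finset (EuclideanSpace ℝ (Fin d))) (hU : U.card = 2 * n) :
    ∃ P Q : Finset (EuclideanSpace ℝ (Fin d)),
      Disjoint P Q ∧ P ∪ Q = U ∧ P.card = n ∧ Q.card = n ∧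
      ‖centroid P - centroid Q‖ ≤
        Metric.diam (U : Set (EuclideanSpace ℝ (Fin d))) / Real.sqrt n := by
  obtain ⟨P, Q, hPQ, hPQU, hP, hQ, hle⟩ := exists_halving_norm_sum_sub_sum_sq_le n U hU
    fun x hx y hy => (dist_eq_norm x y).symm.trans_le <|
      Metric.dist_le_diam_of_mem U.finite_toSet.isBounded (mem_coe.mpr hx) (mem_coe.mpr hy)
  refine ⟨P, Q, hPQ, by convert hPQU, hP, hQ, ?_⟩
  have hn' : (0 : ℝ) < n := by exact_mod_cast hn
  have hdiam : 0 ≤ Metric.diam (U : Set (EuclideanSpace ℝ (Fin d))) := Metric.diam_nonneg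
  refine le_of_sq_le_sq ?_ (by positivity)
  rw [_root_.centroid, _root_.centroid, hP, hQ, ← smul_sub, norm_smul, mul_pow, norm_inv,
    RCLike.norm_natCast, div_pow, Real.sq_sqrt hn'.le, inv_pow, inv_mul_le_iff₀ (by positivity)]
  refine hle.trans_eq ?_
  field_simp
end

section
/- (No-dimensional centerball.) Let P be a set of n points in ℝ^d and let ε ∈ (0, 1/2) be a parameter with n ≥ 27/ε⁴. Then there exists a point x ∈ ℝ^d such that every closed halfspace of ℝ^d containing the closed ball of radius ε·diam(P) centered at x contains at least n/(4/ε² + 9/2) points of P. -/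
open Finset
open scoped Classical RealInnerProductSpace

/-- Let `f` be a real function on a nonempty finite set whose values differ by at most `M`. If `b`
lies at least `ε * M` below the mean of `f`, then `f` is at least `b` on a fraction of at least
`ε / (1 + ε)` of the set. -/
theorem Finset.mul_card_le_card_filter_of_le_mean_sub {ι : Type*} (s : Finset ι)
    (f : ι → ℝ) {M ε b : ℝ} (hs : s.Nonempty) (hM : 0 < M)
    (hf : ∀ p ∈ s, ∀ q ∈ s, f p - f q ≤ M)
    (hb : b ≤ (∑ q ∈ s, f q) / s.card - ε * M) :
    ε * s.card ≤ (1 + ε) * ((s.filter (fun p => b ≤ f p)).card : ℝ) := by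
  set μ := (∑ q ∈ s, f q) / s.card with hμ
  have hn : (0 : ℝ) < s.card := by exact_mod_cast hs.card_pos
  have hsum : ∑ q ∈ s, f q = s.card * μ := by rw [hμ]; field_simp
  have hup : ∀ p ∈ s, f p ≤ μ + M := fun p hp ↦ by
    have h : ∑ q ∈ s, (f p - f q) ≤ ∑ _q ∈ s, M := Finset.sum_le_sum (hf p hp)
    rw [Finset.sum_sub_distrib, Finset.sum_const, Finset.sum_const, nsmul_eq_mul, nsmul_eq_mul,
      hsum, ← mul_sub] at h
    linarith [le_of_mul_le_mul_left h hn]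
  have hbound : ∑ p ∈ s, f p ≤ ∑ p ∈ s, (μ - ε * M + if b ≤ f p then (1 + ε) * M else 0) := by
    refine Finset.sum_le_sum fun p hp ↦ ?_
    split_ifs with h
    · linarith [hup p hp]
    · linarith
  rw [Finset.sum_add_distrib, ← Finset.sum_filter, Finset.sum_const, Finset.sum_const,
    nsmul_eq_mul, nsmul_eq_mul, hsum] at hbound
  refine le_of_mul_le_mul_right ?_ hM
  linarith

/-- A halfspace `{y | b ≤ ⟪a, y⟫}` containing the closed ball of radius `r` around `x` satisfies
`b ≤ ⟪a, x⟫ - r * ‖a‖`. -/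
theorem le_inner_sub_of_closedBall_subset {E : Type*} [NormedAddCommGroup E]
    [InnerProductSpace ℝ E] {x a : E} {r b : ℝ} (ha : a ≠ 0) (hr : 0 ≤ r)
    (h : Metric.closedBall x r ⊆ {y : E | b ≤ ⟪a, y⟫}) : b ≤ ⟪a, x⟫ - r * ‖a‖ := by
  have hna : 0 < ‖a‖ := norm_pos_iff.mpr ha
  have hmem : x - (r / ‖a‖) • a ∈ Metric.closedBall x r := by
    rw [Metric.mem_closedBall, dist_eq_norm, sub_sub_cancel_left, norm_neg, norm_smul,
      Real.norm_of_nonneg (by positivity), div_mul_cancel₀ _ hna.ne']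
  have hy : b ≤ ⟪a, x - (r / ‖a‖) • a⟫ := h hmem
  rw [inner_sub_right, real_inner_smul_right, real_inner_self_eq_norm_sq] at hy
  convert hy using 2
  field_simp

/-- No-dimensional centerball: for `ε ∈ (0, 1/2)` and `n ≥ 27/ε⁴`, there is a point `x`
such that every closed halfspace containing the closed ball of radius `ε · diam(P)`
centered at `x` contains at least `n/(4/ε² + 9/2)` points of `P`. -/
theorem no_dimensional_centerball {d : ℕ} (P : Finset (EuclideanSpace ℝ (Fin d)))
    (n : ℕ) (ε : ℝ) (hn : P.card = n) (hε : 0 < ε ∧ ε < 1 / 2)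
    (hbig : (27 : ℝ) / ε ^ 4 ≤ (n : ℝ)) :
    ∃ x : EuclideanSpace ℝ (Fin d),
      ∀ (a : EuclideanSpace ℝ (Fin d)) (b : ℝ), a ≠ 0 →
        Metric.closedBall x (ε * Metric.diam (P : Set (EuclideanSpace ℝ (Fin d)))) ⊆
          {y : EuclideanSpace ℝ (Fin d) | b ≤ ⟪a, y⟫} →
        (n : ℝ) / (4 / ε ^ 2 + 9 / 2) ≤
          ((P.filter (fun p => b ≤ ⟪a, p⟫)).card : ℝ) := by
  obtain ⟨hε0, hε1⟩ := hε
  subst hn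
  have hcard : (1 : ℝ) < P.card := by
    refine lt_of_lt_of_le ?_ hbig
    rw [lt_div_iff₀ (by positivity)]
    have : ε ^ 4 ≤ 1 := pow_le_one₀ hε0.le (by linarith)
    linarith
  have hntriv : P.Nontrivial := Finset.one_lt_card_iff_nontrivial.mp (by exact_mod_cast hcard)
  have hbdd : Bornology.IsBounded (P : Set (EuclideanSpace ℝ (Fin d))) :=
    P.finite_toSet.isBounded
  set D := Metric.diam (P : Set (EuclideanSpace ℝ (Fin d)))
  have hDpos : 0 < D := by
    obtain ⟨p, hp, q, hq, hpq⟩ := hntriv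
    exact (dist_pos.mpr hpq).trans_le (Metric.dist_le_diam_of_mem hbdd hp hq)
  refine ⟨(P.card : ℝ)⁻¹ • ∑ q ∈ P, q, fun a b ha hsub ↦ ?_⟩
  have hb := le_inner_sub_of_closedBall_subset ha (by positivity) hsub
  rw [real_inner_smul_right, inner_sum, inv_mul_eq_div, mul_assoc] at hb
  have hmain := P.mul_card_le_card_filter_of_le_mean_sub (fun p ↦ ⟪a, p⟫) hntriv.nonempty
    (M := D * ‖a‖) (mul_pos hDpos (norm_pos_iff.mpr ha)) (fun p hp q hq ↦ by
      rw [← inner_sub_right, mul_comm]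
      refine (real_inner_le_norm _ _).trans ?_
      gcongr
      rw [← dist_eq_norm]
      exact Metric.dist_le_diam_of_mem hbdd hp hq) hb
  have hconst : (1 + ε) / ε ≤ 4 / ε ^ 2 + 9 / 2 := by
    rw [div_add_div _ _ (by positivity) (by norm_num), div_le_div_iff₀ hε0 (by positivity)]
    nlinarith [pow_pos hε0 2, pow_pos hε0 3]
  calc (P.card : ℝ) / (4 / ε ^ 2 + 9 / 2) ≤ P.card / ((1 + ε) / ε) := by gcongr
    _ ≤ _ := by
      rw [div_div_eq_mul_div, div_le_iff₀ (by positivity)]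
      linarith
end

section
/- (Deterministic no-dimensional Tverberg partition.) Let P be a set of n points in ℝ^d and let ε ∈ (0, 1/4) be a parameter. Then there exists a partition of P into k pairwise disjoint nonempty sets P_1, …, P_k, and a closed ball B of radius at most ε·diam(P), such that: (i) |P_i| ≤ 8/ε² for every i; (ii) for every i, the convex hull of P_i intersects B; and (iii) k ≥ n·ε²/8. -/
open Finset

section Tverberg

variable {E : Type*} [NormedAddCommGroup E] [InnerProductSpace ℝ E]

/-- A set of `2 * m` points has an equal-size bipartition whose two sums differ by at most
`√m * D`, where `D` bounds the pairwise distances. -/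
theorem exists_balanced_half (D : ℝ) (m : ℕ) (P : Finset E) (hcard : P.card = 2 * m)
    (hD : ∀ p ∈ P, ∀ q ∈ P, ‖p - q‖ ≤ D) :
    ∃ A B : Finset E, Disjoint A B ∧ (A : Set E) ∪ B = P ∧ A.card = m ∧ B.card = m ∧
      ‖∑ p ∈ A, p - ∑ p ∈ B, p‖ ^ 2 ≤ m * D ^ 2 := by
  classical
  induction m generalizing P with
  | zero =>
    have hP : P = ∅ := by simpa using hcard
    exact ⟨∅, ∅, by simp [hP]⟩
  | succ m ih =>
    obtain ⟨a, b, ha, hb, hab⟩ := Finset.one_lt_card_iff.1 (show 1 < P.card by omega)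
    have hb' : b ∈ P.erase a := Finset.mem_erase.2 ⟨hab.symm, hb⟩
    obtain ⟨A, B, hdisj, hun, hA, hB, hle⟩ := ih ((P.erase a).erase b)
      (by rw [Finset.card_erase_of_mem hb', Finset.card_erase_of_mem ha]; omega)
      (fun p hp q hq => hD p (by simp_all) q (by simp_all))
    replace hun : A ∪ B = (P.erase a).erase b :=
      Finset.coe_injective (by rw [Finset.coe_union, hun])
    have key : ∀ x, x ∈ A ∨ x ∈ B ↔ x ≠ b ∧ x ≠ a ∧ x ∈ P := fun x => by
      rw [← Finset.mem_union, hun, Finset.mem_erase, Finset.mem_erase]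
    have haA : a ∉ A := fun h => ((key a).1 (Or.inl h)).2.1 rfl
    have haB : a ∉ B := fun h => ((key a).1 (Or.inr h)).2.1 rfl
    have hbA : b ∉ A := fun h => ((key b).1 (Or.inl h)).1 rfl
    have hbB : b ∉ B := fun h => ((key b).1 (Or.inr h)).1 rfl
    have hsq : ‖a - b‖ ^ 2 ≤ D ^ 2 := pow_le_pow_left₀ (norm_nonneg _) (hD a ha b hb) 2
    set Δ := ∑ p ∈ A, p - ∑ p ∈ B, p with hΔ
    rcases le_total (inner ℝ Δ (a - b)) 0 with h | h
    · refine ⟨insert a A, insert b B, ?_, ?_, ?_, ?_, ?_⟩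
      · simp [haB, hbA, hdisj, hab.symm]
      · ext x
        have := key x
        simp only [Finset.coe_insert, Set.mem_union, Set.mem_insert_iff, Finset.mem_coe]
        by_cases h1 : x = a <;> by_cases h2 : x = b <;> simp_all
      · rw [Finset.card_insert_of_notMem haA, hA]
      · rw [Finset.card_insert_of_notMem hbB, hB]
      · rw [Finset.sum_insert haA, Finset.sum_insert hbB,
          show a + ∑ p ∈ A, p - (b + ∑ p ∈ B, p) = Δ + (a - b) by rw [hΔ]; abel,
          norm_add_sq_real]
        push_cast
        linarith
    · refine ⟨insert b A, insert a B, ?_, ?_, ?_, ?_, ?_⟩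
      · simp [haA, hbB, hdisj, hab]
      · ext x
        have := key x
        simp only [Finset.coe_insert, Set.mem_union, Set.mem_insert_iff, Finset.mem_coe]
        by_cases h1 : x = a <;> by_cases h2 : x = b <;> simp_all
      · rw [Finset.card_insert_of_notMem hbA, hA]
      · rw [Finset.card_insert_of_notMem haB, hB]
      · rw [Finset.sum_insert hbA, Finset.sum_insert haB,
          show b + ∑ p ∈ A, p - (a + ∑ p ∈ B, p) = Δ - (a - b) by rw [hΔ]; abel,
          norm_sub_sq_real]
        push_cast
        linarith

/-- The average of a finite set of points. -/
noncomputable def finsetMean (A : Finset E) : E := (A.card : ℝ)⁻¹ • ∑ p ∈ A, p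

theorem finsetMean_mem_convexHull {A : Finset E} (hA : A.Nonempty) :
    finsetMean A ∈ convexHull ℝ (A : Set E) := by
  have hc : (0 : ℝ) < A.card := by exact_mod_cast hA.card_pos
  rw [finsetMean, Finset.smul_sum]
  refine (convex_convexHull ℝ _).sum_mem (fun _ _ => by positivity) ?_
    (fun p hp => subset_convexHull ℝ _ hp)
  simp [hc.ne']

theorem finsetMean_sub_of_union [DecidableEq E] {A B : Finset E} {m : ℕ} (hm : 0 < m)
    (hdisj : Disjoint A B) (hA : A.card = m) (hB : B.card = m) :
    finsetMean A - finsetMean (A ∪ B) = (2 * m : ℝ)⁻¹ • (∑ p ∈ A, p - ∑ p ∈ B, p) := by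
  have hm' : (m : ℝ) ≠ 0 := by positivity
  rw [finsetMean, finsetMean, Finset.card_union_of_disjoint hdisj,
    Finset.sum_union hdisj, hA, hB]
  push_cast
  match_scalars <;> field_simp <;> ring

/-- `𝒬` partitions `P` into nonempty sets of size at most `M` whose convex hulls meet the closed
ball of radius `r` around `x`. -/
structure IsTverbergPartition (P : Finset E) (𝒬 : Finset (Finset E)) (M : ℕ) (x : E) (r : ℝ) :
    Prop where
  pairwise : ∀ A ∈ 𝒬, ∀ B ∈ 𝒬, A ≠ B → Disjoint A B
  mem_iff : ∀ p, p ∈ P ↔ ∃ A ∈ 𝒬, p ∈ A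
  nonempty : ∀ A ∈ 𝒬, A.Nonempty
  card_le : ∀ A ∈ 𝒬, A.card ≤ M
  hull : ∀ A ∈ 𝒬, (convexHull ℝ (A : Set E) ∩ Metric.closedBall x r).Nonempty

theorem IsTverbergPartition.mono {P : Finset E} {𝒬 : Finset (Finset E)} {M : ℕ} {x y : E}
    {r r' : ℝ} (h : IsTverbergPartition P 𝒬 M x r) (hr : r + dist x y ≤ r') :
    IsTverbergPartition P 𝒬 M y r' :=
  { h with
    hull := fun A hA => (h.hull A hA).mono
      (Set.inter_subset_inter_right _ (Metric.closedBall_subset_closedBall' hr)) }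

theorem IsTverbergPartition.union [DecidableEq E] {P₁ P₂ : Finset E}
    {𝒬₁ 𝒬₂ : Finset (Finset E)} {M : ℕ} {x : E} {r : ℝ}
    (h₁ : IsTverbergPartition P₁ 𝒬₁ M x r) (h₂ : IsTverbergPartition P₂ 𝒬₂ M x r)
    (hP : Disjoint P₁ P₂) : IsTverbergPartition (P₁ ∪ P₂) (𝒬₁ ∪ 𝒬₂) M x r := by
  have hsub₁ : ∀ A ∈ 𝒬₁, A ⊆ P₁ := fun A hA p hp => (h₁.mem_iff p).2 ⟨A, hA, hp⟩
  have hsub₂ : ∀ A ∈ 𝒬₂, A ⊆ P₂ := fun A hA p hp => (h₂.mem_iff p).2 ⟨A, hA, hp⟩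
  refine ⟨?_, ?_, ?_, ?_, ?_⟩
  · intro A hA B hB hAB
    rcases Finset.mem_union.1 hA with hA | hA <;> rcases Finset.mem_union.1 hB with hB | hB
    · exact h₁.pairwise A hA B hB hAB
    · exact hP.mono (hsub₁ A hA) (hsub₂ B hB)
    · exact hP.symm.mono (hsub₂ A hA) (hsub₁ B hB)
    · exact h₂.pairwise A hA B hB hAB
  · intro p
    simp only [Finset.mem_union, h₁.mem_iff, h₂.mem_iff, or_and_right, exists_or]
  · intro A hA
    exact (Finset.mem_union.1 hA).elim (h₁.nonempty A) (h₂.nonempty A)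
  · intro A hA
    exact (Finset.mem_union.1 hA).elim (h₁.card_le A) (h₂.card_le A)
  · intro A hA
    exact (Finset.mem_union.1 hA).elim (h₁.hull A) (h₂.hull A)

theorem isTverbergPartition_singleton {S P : Finset E} {M : ℕ} (hSP : S ⊆ P) (hS : S.Nonempty)
    (hM : P.card ≤ M) {r : ℝ} (hr : 0 ≤ r) :
    IsTverbergPartition P {P} M (finsetMean S) r := by
  refine ⟨by simp, by simp, by simpa using hS.mono hSP, by simpa using hM, ?_⟩
  simp only [Finset.mem_singleton, forall_eq]
  exact ⟨finsetMean S, convexHull_mono (by exact_mod_cast hSP) (finsetMean_mem_convexHull hS),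
    Metric.mem_closedBall_self hr⟩

/-- Repeated halving of a subset `S` of `P` with `2 ^ t * s` points, spreading the remaining points
of `P` evenly. The ratio `5 / 7` is a rational upper bound for `1 / √2`. -/
theorem exists_isTverbergPartition_of_card_eq {D σ : ℝ} {s M : ℕ} (hs : 0 < s) (hσ : 0 ≤ σ)
    (hDσ : D ^ 2 ≤ 4 * s * σ ^ 2) (t : ℕ) (S R : Finset E) (hSR : Disjoint S R)
    (hS : S.card = 2 ^ t * s) (hM : S.card + R.card ≤ 2 ^ t * M)
    (hD : ∀ p ∈ S, ∀ q ∈ S, ‖p - q‖ ≤ D) :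
    ∃ 𝒬, IsTverbergPartition (S.disjUnion R hSR) 𝒬 M (finsetMean S)
      (7 / 2 * σ * (1 - (5 / 7) ^ t)) := by
  classical
  induction t generalizing S R with
  | zero =>
    refine ⟨_, isTverbergPartition_singleton (fun p hp => by simp [hp]) ?_ ?_ (by simp)⟩
    · rw [← Finset.card_pos, hS]; positivity
    · simpa [-Finset.disjUnion_eq_union] using hM
  | succ t ih =>
    have hm : 0 < 2 ^ t * s := by positivity
    obtain ⟨A, B, hAB, hun, hA, hB, hle⟩ := exists_balanced_half D (2 ^ t * s) S
      (by rw [hS]; ring) hD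
    replace hun : A ∪ B = S := Finset.coe_injective (by rw [Finset.coe_union, hun])
    obtain ⟨R₁, hR₁, hR₁c⟩ := Finset.exists_subset_card_eq (Nat.div_le_self R.card 2)
    have hR₂c := Finset.card_sdiff_add_card_eq_card hR₁
    rw [hR₁c] at hR₂c
    have hpow : 2 ^ (t + 1) * M = 2 * (2 ^ t * M) := by ring
    have hpow' : 2 ^ (t + 1) * s = 2 * (2 ^ t * s) := by ring
    have hAS : A ⊆ S := hun ▸ Finset.subset_union_left
    have hBS : B ⊆ S := hun ▸ Finset.subset_union_right
    have hA₁ : Disjoint A R₁ := hSR.mono hAS hR₁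
    have hB₂ : Disjoint B (R \ R₁) := hSR.mono hBS Finset.sdiff_subset
    obtain ⟨𝒬₁, h₁⟩ := ih A R₁ hA₁ hA (by omega)
      (fun p hp q hq => hD p (hAS hp) q (hAS hq))
    obtain ⟨𝒬₂, h₂⟩ := ih B (R \ R₁) hB₂ hB (by omega)
      (fun p hp q hq => hD p (hBS hp) q (hBS hq))
    have hbound : ‖(2 * (2 ^ t * s : ℕ) : ℝ)⁻¹ • (∑ p ∈ A, p - ∑ p ∈ B, p)‖
        ≤ σ * (5 / 7) ^ t := by
      have hm' : (0 : ℝ) < (2 ^ t * s : ℕ) := by exact_mod_cast hm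
      refine le_of_sq_le_sq ?_ (by positivity)
      rw [norm_smul, mul_pow, Real.norm_eq_abs, sq_abs, inv_pow, inv_mul_le_iff₀ (by positivity)]
      refine hle.trans ?_
      have h1 : D ^ 2 ≤ 4 * (2 ^ t * s : ℕ) * (σ ^ 2 * (1 / 2) ^ t) := by
        push_cast
        have : (2 : ℝ) ^ t * (1 / 2) ^ t = 1 := by rw [← mul_pow]; norm_num
        calc D ^ 2 ≤ 4 * s * σ ^ 2 * ((2 : ℝ) ^ t * (1 / 2) ^ t) := by rw [this]; linarith
          _ = _ := by ring
      have h2 : ((1 / 2 : ℝ)) ^ t ≤ ((5 / 7) ^ t) ^ 2 := by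
        rw [← pow_mul, mul_comm, pow_mul]
        exact pow_le_pow_left₀ (by norm_num) (by norm_num) t
      calc ((2 ^ t * s : ℕ) : ℝ) * D ^ 2
          ≤ (2 ^ t * s : ℕ) * (4 * (2 ^ t * s : ℕ) * (σ ^ 2 * ((5 / 7) ^ t) ^ 2)) := by
            refine mul_le_mul_of_nonneg_left (h1.trans ?_) hm'.le
            gcongr
        _ = _ := by ring
    have hr : 7 / 2 * σ * (1 - (5 / 7) ^ t) + σ * (5 / 7) ^ t
        = 7 / 2 * σ * (1 - (5 / 7) ^ (t + 1)) := by ring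
    have hdA : dist (finsetMean A) (finsetMean S) ≤ σ * (5 / 7) ^ t := by
      rw [dist_eq_norm, ← hun, finsetMean_sub_of_union hm hAB hA hB]
      exact hbound
    have hdB : dist (finsetMean B) (finsetMean S) ≤ σ * (5 / 7) ^ t := by
      rw [dist_eq_norm, ← hun, Finset.union_comm, finsetMean_sub_of_union hm hAB.symm hB hA,
        ← norm_neg, ← smul_neg, neg_sub]
      exact hbound
    have h := (h₁.mono (y := finsetMean S) (by rw [← hr]; gcongr)).union
      (h₂.mono (y := finsetMean S) (r' := 7 / 2 * σ * (1 - (5 / 7) ^ (t + 1)))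
        (by rw [← hr]; gcongr)) ?_
    · refine ⟨𝒬₁ ∪ 𝒬₂, ?_⟩
      convert h using 1
      ext p
      have := @hR₁ p
      simp only [← hun, Finset.mem_disjUnion, Finset.mem_union, Finset.mem_sdiff]
      tauto
    · rw [Finset.disjUnion_eq_union, Finset.disjUnion_eq_union, Finset.disjoint_union_left,
        Finset.disjoint_union_right, Finset.disjoint_union_right]
      exact ⟨⟨hAB, hSR.mono hAS Finset.sdiff_subset⟩, (hSR.mono hBS hR₁).symm,
        Finset.disjoint_sdiff⟩

theorem exists_isTverbergPartition {D ε : ℝ} (hD₀ : 0 ≤ D) (hε₀ : 0 < ε) (hε : ε < 1 / 4)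
    (P : Finset E) (hD : ∀ p ∈ P, ∀ q ∈ P, ‖p - q‖ ≤ D) :
    ∃ 𝒬 x, IsTverbergPartition P 𝒬 ⌊8 / ε ^ 2⌋₊ x (ε * D) := by
  classical
  set M := ⌊8 / ε ^ 2⌋₊ with hMdef
  rcases P.eq_empty_or_nonempty with rfl | hP
  · exact ⟨∅, 0, by constructor <;> simp⟩
  rcases le_or_gt P.card M with hPM | hPM
  · exact ⟨{P}, _, isTverbergPartition_singleton subset_rfl hP hPM (by positivity)⟩
  have hε2 : ε ^ 2 < 1 / 16 := by nlinarith
  have hε2' : 0 < ε ^ 2 := by positivity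
  have hM : 8 < (M + 1) * ε ^ 2 := (div_lt_iff₀ hε2').1 (Nat.lt_floor_add_one (8 / ε ^ 2))
  have hM₀ : 1 ≤ M := by
    rw [hMdef, Nat.one_le_floor_iff, le_div_iff₀ hε2']
    linarith
  have hex : ∃ t, P.card ≤ 2 ^ t * M :=
    ⟨P.card, Nat.lt_two_pow_self.le.trans (Nat.le_mul_of_pos_right _ hM₀)⟩
  obtain ⟨t, ht, hmin⟩ : ∃ t, P.card ≤ 2 ^ (t + 1) * M ∧ 2 ^ t * M < P.card := by
    rcases h : Nat.find hex with _ | t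
    · have := Nat.find_spec hex
      rw [h] at this
      omega
    · refine ⟨t, h ▸ Nat.find_spec hex, ?_⟩
      exact not_le.1 (Nat.find_min hex (h ▸ Nat.lt_succ_self t))
  set s := P.card / 2 ^ (t + 1) with hs
  have hsM : M + 1 ≤ 2 * (s + 1) := by
    have h1 : P.card < 2 ^ (t + 1) * (s + 1) := Nat.lt_mul_div_succ _ (by positivity)
    have h2 : 2 ^ t * M < 2 ^ t * (2 * (s + 1)) := by
      calc 2 ^ t * M < 2 ^ (t + 1) * (s + 1) := hmin.trans h1
        _ = _ := by ring
    exact Nat.lt_of_mul_lt_mul_left h2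
  have hsε : 49 / 16 ≤ s * ε ^ 2 := by
    have : ((M : ℝ) + 1) ≤ 2 * (s + 1) := by exact_mod_cast hsM
    nlinarith
  have hs₀ : 0 < s := by
    rcases Nat.eq_zero_or_pos s with h | h
    · rw [h] at hsε
      norm_num at hsε
    · exact h
  obtain ⟨S, hSP, hSc⟩ := Finset.exists_subset_card_eq
    (show 2 ^ (t + 1) * s ≤ P.card from Nat.mul_div_le _ _)
  obtain ⟨𝒬, h⟩ := exists_isTverbergPartition_of_card_eq (D := D) (σ := 2 / 7 * (ε * D)) (M := M)
    hs₀ (by positivity) (by nlinarith [mul_le_mul_of_nonneg_right hsε (sq_nonneg D)]) (t + 1)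
    S (P \ S) Finset.disjoint_sdiff hSc
    (by rw [add_comm, Finset.card_sdiff_add_card_eq_card hSP]; exact ht)
    (fun p hp q hq => hD p (hSP hp) q (hSP hq))
  refine ⟨𝒬, finsetMean S, ?_⟩
  rw [Finset.disjUnion_eq_union, Finset.union_sdiff_of_subset hSP] at h
  refine h.mono ?_
  rw [dist_self]
  have : 0 ≤ ε * D * (5 / 7) ^ (t + 1) := by positivity
  linarith

end Tverberg

/-- Deterministic no-dimensional Tverberg partition: for `ε ∈ (0, 1/4)`, the set `P`
can be partitioned into `k ≥ n ε²/8` nonempty sets, each of size at most `8/ε²`, whose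
convex hulls all intersect a common closed ball of radius at most `ε · diam(P)`. -/
theorem deterministic_tverberg_partition {d : ℕ}
    (P : Finset (EuclideanSpace ℝ (Fin d))) (n : ℕ) (ε : ℝ)
    (hn : P.card = n) (hε : 0 < ε ∧ ε < 1 / 4) :
    ∃ (k : ℕ) (Q : Fin k → Finset (EuclideanSpace ℝ (Fin d)))
      (x : EuclideanSpace ℝ (Fin d)) (ρ : ℝ),
      ρ ≤ ε * Metric.diam (P : Set (EuclideanSpace ℝ (Fin d))) ∧
      (∀ i, (Q i).Nonempty) ∧
      (∀ i j, i ≠ j → Disjoint (Q i) (Q j)) ∧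
      (⋃ i, (Q i : Set (EuclideanSpace ℝ (Fin d)))) = (P : Set (EuclideanSpace ℝ (Fin d))) ∧
      (∀ i, ((Q i).card : ℝ) ≤ 8 / ε ^ 2) ∧
      (∀ i, (convexHull ℝ (Q i : Set (EuclideanSpace ℝ (Fin d))) ∩
          Metric.closedBall x ρ).Nonempty) ∧
      (n : ℝ) * ε ^ 2 / 8 ≤ (k : ℝ) := by
  classical
  subst hn
  obtain ⟨𝒬, x, h⟩ := exists_isTverbergPartition 
    (D := Metric.diam (P : Set (EuclideanSpace ℝ (Fin d)))) Metric.diam_nonneg hε.1 hε.2 P (fun p hp q hq => by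
      rw [← dist_eq_norm]
      exact Metric.dist_le_diam_of_mem P.finite_toSet.isBounded hp hq)
  have hε2 : 0 < ε ^ 2 := pow_pos hε.1 2
  have hcard : ∀ A ∈ 𝒬, (A.card : ℝ) ≤ 8 / ε ^ 2 := fun A hA =>
    (Nat.cast_le.2 (h.card_le A hA)).trans (Nat.floor_le (by positivity))
  have hinj : ∀ i j, i ≠ j → (𝒬.equivFin.symm i).1 ≠ (𝒬.equivFin.symm j).1 :=
    fun i j hij he => hij (𝒬.equivFin.symm.injective (Subtype.ext he))
  refine ⟨𝒬.card, fun i => 𝒬.equivFin.symm i, x, _, le_rfl,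
    fun i => h.nonempty _ (𝒬.equivFin.symm i).2,
    fun i j hij => h.pairwise _ (𝒬.equivFin.symm i).2 _ (𝒬.equivFin.symm j).2 (hinj i j hij),
    ?_, fun i => hcard _ (𝒬.equivFin.symm i).2, fun i => h.hull _ (𝒬.equivFin.symm i).2, ?_⟩
  · ext p
    rw [Finset.mem_coe, h.mem_iff, Set.mem_iUnion]
    constructor
    · rintro ⟨i, hi⟩
      exact ⟨_, (𝒬.equivFin.symm i).2, hi⟩
    · rintro ⟨A, hA, hp⟩
      exact ⟨𝒬.equivFin ⟨A, hA⟩, by simpa using hp⟩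
  · have hP : P = 𝒬.biUnion id := by
      ext p
      simp [h.mem_iff]
    have h1 : (P.card : ℝ) ≤ 𝒬.card * (8 / ε ^ 2) := by
      calc (P.card : ℝ) ≤ ∑ A ∈ 𝒬, (A.card : ℝ) := by
            rw [hP]
            exact_mod_cast Finset.card_biUnion_le
        _ ≤ ∑ _A ∈ 𝒬, 8 / ε ^ 2 := Finset.sum_le_sum hcard
        _ = _ := by simp
    rw [← mul_div_assoc, le_div_iff₀ hε2] at h1
    linarith
end

section
/- (No-dimensional Carathéodory theorem.) Let P be a finite set of points in ℝ^d with Δ = diam(P), let ε ∈ (0,1) be a parameter, and let p be any point in the convex hull of P. Then there exists a point q ∈ conv(P) such that q is a convex combination of at most ⌈1/(2ε²)⌉ points of P and ‖p − q‖ ≤ ε·Δ. -/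
open Finset

section Maurey

variable {E : Type*} [NormedAddCommGroup E] [InnerProductSpace ℝ E]

/-- Expansion of a weighted second moment around the weighted mean `p`. -/
theorem sum_mul_norm_add_sub_sq {P : Finset E} {w : E → ℝ} {p : E}
    (hw : ∑ x ∈ P, w x = 1) (hp : ∑ x ∈ P, w x • x = p) (v : E) :
    ∑ x ∈ P, w x * ‖v + (x - p)‖ ^ 2 = ‖v‖ ^ 2 + ∑ x ∈ P, w x * ‖x - p‖ ^ 2 := by
  have hmean : ∑ x ∈ P, w x * inner ℝ v (x - p) = 0 := by
    simp_rw [← real_inner_smul_right, ← inner_sum, smul_sub, sum_sub_distrib, ← sum_smul, hw, hp,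
      one_smul, sub_self, inner_zero_right]
  calc ∑ x ∈ P, w x * ‖v + (x - p)‖ ^ 2
      = ∑ x ∈ P, (w x * ‖v‖ ^ 2 + 2 * (w x * inner ℝ v (x - p)) + w x * ‖x - p‖ ^ 2) := by
        refine sum_congr rfl fun x _ => ?_
        rw [norm_add_sq_real]
        ring
    _ = ‖v‖ ^ 2 + ∑ x ∈ P, w x * ‖x - p‖ ^ 2 := by
        rw [sum_add_distrib, sum_add_distrib, ← mul_sum, ← sum_mul, hw, hmean]
        ring

/-- The variance of a weighted finite set is at most half the square of its diameter. -/
theorem two_mul_sum_mul_norm_sub_sq_le {P : Finset E} {w : E → ℝ} {p : E}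
    (hw₀ : ∀ x ∈ P, 0 ≤ w x) (hw : ∑ x ∈ P, w x = 1) (hp : ∑ x ∈ P, w x • x = p) :
    2 * ∑ x ∈ P, w x * ‖x - p‖ ^ 2 ≤ Metric.diam (P : Set E) ^ 2 := by
  set V := ∑ x ∈ P, w x * ‖x - p‖ ^ 2 with hV
  have hle : ∀ y ∈ P, ‖y - p‖ ^ 2 + V ≤ Metric.diam (P : Set E) ^ 2 := by
    intro y hy
    rw [norm_sub_rev, hV, ← sum_mul_norm_add_sub_sq hw hp]
    calc ∑ x ∈ P, w x * ‖p - y + (x - p)‖ ^ 2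
        ≤ ∑ x ∈ P, w x * Metric.diam (P : Set E) ^ 2 := by
          refine sum_le_sum fun x hx => mul_le_mul_of_nonneg_left ?_ (hw₀ x hx)
          have hxy : p - y + (x - p) = x - y := by abel
          rw [hxy, ← dist_eq_norm]
          exact pow_le_pow_left₀ dist_nonneg
            (Metric.dist_le_diam_of_mem P.finite_toSet.isBounded hx hy) 2
      _ = Metric.diam (P : Set E) ^ 2 := by rw [← sum_mul, hw, one_mul]
  have hsum := sum_le_sum fun y hy => mul_le_mul_of_nonneg_left (hle y hy) (hw₀ y hy)
  simp_rw [mul_add, sum_add_distrib, ← sum_mul, hw, ← hV] at hsum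
  linarith

/-- Some `n` points of a weighted finite set have a sum of deviations from the mean that is
no larger than it is on average. -/
theorem exists_norm_sum_sub_sq_le {P : Finset E} {w : E → ℝ} {p : E}
    (hw₀ : ∀ x ∈ P, 0 ≤ w x) (hw : ∑ x ∈ P, w x = 1) (hp : ∑ x ∈ P, w x • x = p) (n : ℕ) :
    ∃ f : Fin n → E, (∀ i, f i ∈ P) ∧
      ‖∑ i, (f i - p)‖ ^ 2 ≤ n * ∑ x ∈ P, w x * ‖x - p‖ ^ 2 := by
  induction n with
  | zero => exact ⟨Fin.elim0, fun i => i.elim0, by simp⟩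
  | succ n ih =>
    obtain ⟨f, hf, hfn⟩ := ih
    set V := ∑ x ∈ P, w x * ‖x - p‖ ^ 2 with hV
    set v := ∑ i, (f i - p)
    obtain ⟨x, hx, hxv⟩ : ∃ x ∈ P, ‖v + (x - p)‖ ^ 2 ≤ ‖v‖ ^ 2 + V := by
      by_contra! h
      have hpos : ∃ x ∈ P, 0 < w x := exists_lt_of_sum_lt (by simp [hw])
      obtain ⟨y, hy, hwy⟩ := hpos
      have hlt : ∑ x ∈ P, w x * (‖v‖ ^ 2 + V) < ∑ x ∈ P, w x * ‖v + (x - p)‖ ^ 2 :=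
        sum_lt_sum (fun x hx => mul_le_mul_of_nonneg_left (h x hx).le (hw₀ x hx))
          ⟨y, hy, mul_lt_mul_of_pos_left (h y hy) hwy⟩
      rw [sum_mul_norm_add_sub_sq hw hp, ← sum_mul, hw, one_mul] at hlt
      exact lt_irrefl _ hlt
    refine ⟨Fin.snoc f x, fun i => ?_, ?_⟩
    · refine Fin.lastCases ?_ (fun j => ?_) i
      · simpa using hx
      · simpa using hf j
    · simp only [Fin.sum_univ_castSucc, Fin.snoc_castSucc, Fin.snoc_last]
      push_cast
      linarith

end Maurey

/-- No-dimensional Carathéodory theorem: for any `p ∈ conv(P)` and `ε ∈ (0,1)`, there is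
a point `q ∈ conv(P)` that is a convex combination of at most `⌈1/(2ε²)⌉` points of `P`
with `‖p - q‖ ≤ ε · diam(P)`. -/
theorem no_dimensional_caratheodory {d : ℕ} (P : Finset (EuclideanSpace ℝ (Fin d)))
    (ε Δ : ℝ) (hΔ : Δ = Metric.diam (P : Set (EuclideanSpace ℝ (Fin d))))
    (hε : ε ∈ Set.Ioo (0 : ℝ) 1)
    (p : EuclideanSpace ℝ (Fin d))
    (hp : p ∈ convexHull ℝ (P : Set (EuclideanSpace ℝ (Fin d)))) :
    ∃ q ∈ convexHull ℝ (P : Set (EuclideanSpace ℝ (Fin d))),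
      ‖p - q‖ ≤ ε * Δ ∧
      ∃ (m : ℕ) (f : Fin m → EuclideanSpace ℝ (Fin d)) (lam : Fin m → ℝ),
        m ≤ ⌈1 / (2 * ε ^ 2)⌉₊ ∧ (∀ i, f i ∈ P) ∧ (∀ i, 0 ≤ lam i) ∧
        ∑ i, lam i = 1 ∧ q = ∑ i, lam i • f i := by
  obtain ⟨hε₀, -⟩ := hε
  obtain ⟨w, hw₀, hw, hwp⟩ := Finset.mem_convexHull'.1 hp
  set n := ⌈1 / (2 * ε ^ 2)⌉₊ with hn
  have hn₀ : 0 < (n : ℝ) := Nat.cast_pos.2 (Nat.ceil_pos.2 (by positivity))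
  have hnε : 1 ≤ n * (2 * ε ^ 2) := (div_le_iff₀ (by positivity)).1 (Nat.le_ceil _)
  have hV := two_mul_sum_mul_norm_sub_sq_le hw₀ hw hwp
  obtain ⟨f, hf, hfn⟩ := exists_norm_sum_sub_sq_le hw₀ hw hwp n
  have hΔ₀ : 0 ≤ Δ := hΔ ▸ Metric.diam_nonneg
  rw [← hΔ] at hV
  have hsum : ∑ _i : Fin n, (n : ℝ)⁻¹ = 1 := by simp [hn₀.ne']
  refine ⟨∑ i, (n : ℝ)⁻¹ • f i, ?_, ?_, n, f, fun _ => (n : ℝ)⁻¹, le_rfl, hf,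
    fun _ => by positivity, hsum, rfl⟩
  · exact (convex_convexHull ℝ _).sum_mem (fun _ _ => by positivity) hsum
      fun i _ => subset_convexHull ℝ _ (hf i)
  · have hdiff : ∑ i, (f i - p) = (n : ℝ) • (∑ i, (n : ℝ)⁻¹ • f i - p) := by
      rw [← smul_sum, smul_sub, smul_inv_smul₀ hn₀.ne', sum_sub_distrib]
      simp [Nat.cast_smul_eq_nsmul]
    rw [hdiff, norm_smul, Real.norm_natCast, norm_sub_rev] at hfn
    refine le_of_mul_le_mul_left (abs_le_of_sq_le_sq' ?_ (by positivity)).2 hn₀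
    calc ((n : ℝ) * ‖p - ∑ i, (n : ℝ)⁻¹ • f i‖) ^ 2
        ≤ n * (Δ ^ 2 / 2) := hfn.trans (mul_le_mul_of_nonneg_left (by linarith) hn₀.le)
      _ ≤ n * (Δ ^ 2 / 2) * (n * (2 * ε ^ 2)) := le_mul_of_one_le_right (by positivity) hnε
      _ = (n * (ε * Δ)) ^ 2 := by ring
end
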